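/- Let Ω ⊆ ℝ^{m+1} (m ≥ 1) be a domain and let Qφ = a^{ij}(x,Dφ)D_{ij}φ + b(x,φ,Dφ) be a quasilinear second-order operator whose coefficients a^{ij}(x,p) are C^∞ on Ω×ℝ^{m+1} and b(x,z,p) is C^∞ on Ω×ℝ×ℝ^{m+1}. Let φ, ψ ∈ C^∞(Ω) satisfy Qφ ≥ Qψ in Ω. Assume: (1) the matrix (a^{ij}(x,p)) is symmetric and nonnegative definite for all (x,p); (2) ∂b/∂z ≤ 0 everywhere; (3) there exist C^∞ vector fields X₁,...,X_r and Y on Ω such that, as second-order differential operators acting on C² functions, a^{ij}(x,Dφ(x))∂_i∂_j = Σ_{k=1}^r X_k² + Y. Let Γ be an integral curve of a vector field Z ∈ £(X₁,...,X_r). If φ − ψ attains a nonnegative maximum over Ω at some point of Γ, then φ − ψ equals that maximum at every point of Γ. -/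

import Mathlib

open Set Finset

noncomputable section

/-- The `k`-th standard basis vector of `ℝ^N` (zero if `k ≥ N`). -/
def ee (N k : ℕ) : Fin N → ℝ := fun i => if (i : ℕ) = k then 1 else 0

/-- The `k`-th partial derivative. -/
def pd (N k : ℕ) (f : (Fin N → ℝ) → ℝ) (x : Fin N → ℝ) : ℝ := fderiv ℝ f x (ee N k)

/-- The gradient `Dφ = (∂₁φ,...,∂_Nφ)`. -/
def grad (N : ℕ) (f : (Fin N → ℝ) → ℝ) (x : Fin N → ℝ) : Fin N → ℝ :=
  fun i => pd N i f x

/-- Derivative of `f` along the vector field `X`. -/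
def vApp {N : ℕ} (X : (Fin N → ℝ) → (Fin N → ℝ)) (f : (Fin N → ℝ) → ℝ) (x : Fin N → ℝ) : ℝ :=
  fderiv ℝ f x (X x)

/-- Lie bracket of vector fields. -/
def lieBr {N : ℕ} (X Y : (Fin N → ℝ) → (Fin N → ℝ)) : (Fin N → ℝ) → (Fin N → ℝ) :=
  fun x => fderiv ℝ Y x (X x) - fderiv ℝ X x (Y x)

/-- `£(S)`: the smallest `C^∞`-module of vector fields containing `S`
and closed under Lie bracket. -/
inductive LieSpan {N : ℕ} (Ω : Set (Fin N → ℝ)) (S : Set ((Fin N → ℝ) → (Fin N → ℝ))) :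
    ((Fin N → ℝ) → (Fin N → ℝ)) → Prop
  | base : ∀ X ∈ S, LieSpan Ω S X
  | smul : ∀ (f : (Fin N → ℝ) → ℝ) (X : (Fin N → ℝ) → (Fin N → ℝ)),
      ContDiffOn ℝ (⊤ : ℕ∞) f Ω → LieSpan Ω S X → LieSpan Ω S (fun x => f x • X x)
  | add : ∀ X Y, LieSpan Ω S X → LieSpan Ω S Y → LieSpan Ω S (fun x => X x + Y x)
  | bracket : ∀ X Y, LieSpan Ω S X → LieSpan Ω S Y → LieSpan Ω S (lieBr X Y)

/-- The quasilinear operator `Qφ = a^{ij}(x,Dφ)D_{ij}φ + b(x,φ,Dφ)`. -/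
def Qop (N : ℕ) (a : (Fin N → ℝ) → (Fin N → ℝ) → Matrix (Fin N) (Fin N) ℝ)
    (b : (Fin N → ℝ) → ℝ → (Fin N → ℝ) → ℝ)
    (f : (Fin N → ℝ) → ℝ) (x : Fin N → ℝ) : ℝ :=
  (∑ i, ∑ j, a x (grad N f x) i j * pd N i (pd N j f) x) + b x (f x) (grad N f x)

open Filter Topology Matrix

/-- A vector field `X` is tangent to `F` in Bony's sense: it is orthogonal to every exterior
normal `c - p` at every point `p ∈ F` which is locally a nearest point of `F` to `c`. -/
def TangentTo {N : ℕ} (F : Set (Fin N → ℝ)) (X : (Fin N → ℝ) → (Fin N → ℝ)) : Prop :=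
  ∀ p ∈ F, ∀ c : Fin N → ℝ,
    (∀ᶠ x in 𝓝 p, x ∈ F → (c - p) ⬝ᵥ (c - p) ≤ (c - x) ⬝ᵥ (c - x)) → (c - p) ⬝ᵥ X p = 0

section SecondOrder

variable {E : Type*} [NormedAddCommGroup E] [NormedSpace ℝ E]

theorem ContDiffAt.hasFDerivAt_fderiv {f : E → ℝ} {x : E} (hf : ContDiffAt ℝ 2 f x) :
    HasFDerivAt (fderiv ℝ f) (fderiv ℝ (fderiv ℝ f) x) x :=
  ((hf.fderiv_right (m := 1) (by norm_num)).differentiableAt one_ne_zero).hasFDerivAt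

theorem ContDiffAt.eventually_differentiableAt {f : E → ℝ} {x : E} (hf : ContDiffAt ℝ 2 f x) :
    ∀ᶠ z in 𝓝 x, DifferentiableAt ℝ f z :=
  (hf.eventually (by simp)).mono fun _ hz => hz.differentiableAt two_ne_zero

theorem IsLocalMax.fderiv_fderiv_apply_self_nonpos {f : E → ℝ} {x : E}
    (hmax : IsLocalMax f x) (hf : ContDiffAt ℝ 2 f x) (v : E) :
    fderiv ℝ (fderiv ℝ f) x v v ≤ 0 := by
  by_contra! hpos
  have hl : ∀ t : ℝ, HasDerivAt (fun t : ℝ => x + t • v) v t := fun t => by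
    simpa using ((hasDerivAt_id t).smul_const v).const_add x
  have hl0 : Tendsto (fun t : ℝ => x + t • v) (𝓝 0) (𝓝 x) := by
    simpa using (hl 0).continuousAt.tendsto
  have hd : ∀ᶠ t in 𝓝 (0 : ℝ),
      HasDerivAt (fun t : ℝ => f (x + t • v)) (fderiv ℝ f (x + t • v) v) t := by
    filter_upwards [hl0.eventually hf.eventually_differentiableAt] with t ht
    exact ht.hasFDerivAt.comp_hasDerivAt t (hl t)
  have hderiv : deriv (fun t : ℝ => f (x + t • v)) =ᶠ[𝓝 0]
      fun t => fderiv ℝ f (x + t • v) v := hd.mono fun t ht => ht.deriv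
  have hdd : deriv (deriv (fun t : ℝ => f (x + t • v))) 0 = fderiv ℝ (fderiv ℝ f) x v v := by
    rw [hderiv.deriv_eq]
    have h1 : HasFDerivAt (fderiv ℝ f) (fderiv ℝ (fderiv ℝ f) x) (x + (0 : ℝ) • v) := by
      simpa using hf.hasFDerivAt_fderiv
    have h2 := h1.comp_hasDerivAt (0 : ℝ) (hl 0)
    exact (h2.clm_apply (hasDerivAt_const (0 : ℝ) v)).deriv.trans (by simp)
  have hmax0 : IsLocalMax (fun t : ℝ => f (x + t • v)) 0 := by
    have := hl0.eventually hmax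
    simpa [IsLocalMax, IsMaxFilter] using this
  have hmin0 : IsLocalMin (fun t : ℝ => f (x + t • v)) 0 :=
    isLocalMin_of_deriv_deriv_pos (by rw [hdd]; exact hpos) hmax0.deriv_eq_zero
      hd.self_of_nhds.continuousAt
  have hconst : (fun t : ℝ => f (x + t • v)) =ᶠ[𝓝 0] fun _ => f (x + (0 : ℝ) • v) := by
    filter_upwards [hmax0, hmin0] with t h1 h2 using le_antisymm h1 h2
  have h0 : deriv (deriv (fun t : ℝ => f (x + t • v))) 0 = 0 := by
    rw [hconst.deriv.deriv_eq]; simp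
  linarith [hdd ▸ h0]

theorem fderiv_add_const_mul_sq {g : E → ℝ} (hg : ContDiff ℝ 2 g) (K : ℝ) :
    fderiv ℝ (fun z => g z + K * g z ^ 2) = fun z => (1 + 2 * K * g z) • fderiv ℝ g z := by
  funext z
  have h := (hg.differentiable two_ne_zero z).hasFDerivAt
  refine (h.add ((h.pow 2).const_mul K)).fderiv.trans ?_
  ext v
  simp
  ring

theorem fderiv_fderiv_add_const_mul_sq_apply {g : E → ℝ} (hg : ContDiff ℝ 2 g) (K : ℝ) {y : E}
    (hy : g y = 0) (v : E) :
    fderiv ℝ (fderiv ℝ (fun z => g z + K * g z ^ 2)) y v v =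
      fderiv ℝ (fderiv ℝ g) y v v + 2 * K * (fderiv ℝ g y v) ^ 2 := by
  rw [fderiv_add_const_mul_sq hg]
  have h := (hg.differentiable two_ne_zero y).hasFDerivAt
  have h1 : HasFDerivAt (fun z => 1 + 2 * K * g z) ((2 * K) • fderiv ℝ g y) y :=
    (h.const_mul (2 * K)).const_add 1
  refine (congrArg (fun T => T v v) (h1.smul hg.contDiffAt.hasFDerivAt_fderiv).fderiv).trans ?_
  simp [hy]
  ring

/-- Hopf-type lemma: a function satisfying a second order differential inequality with principal
part `∑ X_k²` has its maximum set characteristic with respect to every `X_k`. -/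
theorem fderiv_apply_eq_zero_of_local_max_set {r : ℕ} [ProperSpace E] {u g : E → ℝ}
    {X : Fin r → E → E} {y : E} {C : ℝ}
    (hu : ContDiffAt ℝ 2 u y) (hg : ContDiff ℝ 2 g) (hX : ∀ k, ContinuousAt (X k) y)
    (hineq : ∀ᶠ z in 𝓝 y, 0 ≤ ∑ k, fderiv ℝ (fderiv ℝ u) z (X k z) (X k z)
      + C * ‖fderiv ℝ u z‖ + C * max (-u z) 0)
    (hC : 0 ≤ C) (hmax : IsLocalMax u y) (hnn : 0 ≤ u y) (hgy : g y = 0)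
    (hlt : ∀ᶠ z in 𝓝 y, z ≠ y → u z = u y → g z < 0) (k : Fin r) :
    fderiv ℝ g y (X k y) = 0 := by
  by_contra hne
  set S : ℝ := ∑ k, (fderiv ℝ g y (X k y)) ^ 2 with hS
  have hSpos : 0 < S :=
    Finset.sum_pos' (fun _ _ => sq_nonneg _) ⟨k, Finset.mem_univ k, by positivity⟩
  set R : ℝ := ∑ k, fderiv ℝ (fderiv ℝ g) y (X k y) (X k y) - C * ‖fderiv ℝ g y‖ with hR
  obtain ⟨K, hK⟩ : ∃ K : ℝ, 0 < R + 2 * K * S := by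
    refine ⟨(1 - R) / (2 * S), ?_⟩
    field_simp
    linarith
  set h : E → ℝ := fun z => g z + K * g z ^ 2 with hh
  have hh2 : ContDiff ℝ 2 h := hg.add (contDiff_const.mul (hg.pow 2))
  have hhy : h y = 0 := by simp [hh, hgy]
  have hcont : ContinuousAt (fun z => ∑ k, fderiv ℝ (fderiv ℝ h) z (X k z) (X k z)
      - C * ‖fderiv ℝ h z‖ - C * max (h z) 0) y := by
    have c1 : Continuous (fderiv ℝ h) := hh2.continuous_fderiv two_ne_zero
    have c2 : Continuous (fderiv ℝ (fderiv ℝ h)) :=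
      (hh2.fderiv_right (m := 1) (by norm_num)).continuous_fderiv one_ne_zero
    have c3 := hh2.continuous
    refine ((tendsto_finsetSum _ fun k _ => ?_).sub ?_).sub ?_
    · exact (c2.continuousAt.clm_apply (hX k)).clm_apply (hX k)
    · exact (continuous_const.mul c1.norm).continuousAt
    · exact (continuous_const.mul (c3.max continuous_const)).continuousAt
  have hpos : ∀ᶠ z in 𝓝 y, 0 < ∑ k, fderiv ℝ (fderiv ℝ h) z (X k z) (X k z)
      - C * ‖fderiv ℝ h z‖ - C * max (h z) 0 := by
    refine hcont.eventually_const_lt ?_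
    have hD1 : fderiv ℝ h y = fderiv ℝ g y := by
      simp [hh, fderiv_add_const_mul_sq hg K, hgy]
    have hD2 : ∀ v, fderiv ℝ (fderiv ℝ h) y v v =
        fderiv ℝ (fderiv ℝ g) y v v + 2 * K * (fderiv ℝ g y v) ^ 2 :=
      fderiv_fderiv_add_const_mul_sq_apply hg K hgy
    simp only [hhy, hD1, hD2, max_self, mul_zero, sub_zero, Finset.sum_add_distrib,
      ← Finset.mul_sum]
    linarith
  have hneg : ∀ᶠ z in 𝓝 y, 0 < 1 + K * g z := by
    have : ContinuousAt (fun z => 1 + K * g z) y := by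
      have := hg.continuous
      fun_prop
    exact this.eventually_const_lt (by simp [hgy])
  have hall := (hu.eventually (by simp)).and (hineq.and (hmax.and (hlt.and (hpos.and hneg))))
  obtain ⟨ρ, hρ, hball⟩ := Metric.nhds_basis_closedBall.eventually_iff.1 hall
  have hsph : ∀ z ∈ Metric.sphere y ρ, z ∈ Metric.closedBall y ρ ∧ z ≠ y := fun z hz =>
    ⟨Metric.sphere_subset_closedBall hz, Metric.ne_of_mem_sphere hz hρ.ne'⟩
  have huc : ContinuousOn u (Metric.closedBall y ρ) := fun z hz =>
    (hball hz).1.continuousAt.continuousWithinAt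
  obtain ⟨ε, hε, hbd⟩ : ∃ ε > 0, ∀ z ∈ Metric.sphere y ρ, u z + ε * h z < u y := by
    have hcpt : IsCompact (Metric.sphere y ρ ∩ {z | 0 ≤ h z}) :=
      (isCompact_sphere y ρ).inter_right (isClosed_le continuous_const hh2.continuous)
    have hout : ∀ z ∈ Metric.sphere y ρ, h z < 0 → ∀ ε > 0, u z + ε * h z < u y := by
      intro z hz hlt ε hε
      have := (hball (hsph z hz).1).2.2.1
      nlinarith
    rcases (Metric.sphere y ρ ∩ {z | 0 ≤ h z}).eq_empty_or_nonempty with hem | hnem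
    · refine ⟨1, one_pos, fun z hz => hout z hz ?_ 1 one_pos⟩
      by_contra! hc
      exact (hem ▸ (⟨hz, hc⟩ : z ∈ Metric.sphere y ρ ∩ {z | 0 ≤ h z}) : z ∈ (∅ : Set E))
    obtain ⟨z₁, hz₁, hz₁max⟩ := hcpt.exists_isMaxOn hnem
      (huc.mono fun z hz => (hsph z hz.1).1)
    obtain ⟨z₂, hz₂, hz₂max⟩ := hcpt.exists_isMaxOn hnem hh2.continuous.continuousOn
    have hlt1 : u z₁ < u y := by
      obtain ⟨-, -, h3, h4, -, h6⟩ := hball (hsph z₁ hz₁.1).1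
      refine lt_of_le_of_ne h3 fun heq => ?_
      have h7 := h4 (hsph z₁ hz₁.1).2 heq
      have h8 : 0 ≤ h z₁ := hz₁.2
      have h9 : h z₁ = g z₁ * (1 + K * g z₁) := by simp only [hh]; ring
      nlinarith
    have h20 : 0 ≤ h z₂ := hz₂.2
    refine ⟨(u y - u z₁) / (2 * (h z₂ + 1)), by apply div_pos <;> linarith, fun z hz => ?_⟩
    have he : 0 < (u y - u z₁) / (2 * (h z₂ + 1)) := by apply div_pos <;> linarith
    rcases lt_or_ge (h z) 0 with hc | hc
    · exact hout z hz hc _ he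
    · have e1 : u z ≤ u z₁ := hz₁max ⟨hz, hc⟩
      have e2 : h z ≤ h z₂ := hz₂max ⟨hz, hc⟩
      have e3 : (u y - u z₁) / (2 * (h z₂ + 1)) * (h z₂ + 1) = (u y - u z₁) / 2 := by
        field_simp
      nlinarith
  set w : E → ℝ := fun z => u z + ε * h z with hw
  obtain ⟨z, hz, hzmax⟩ := (isCompact_closedBall y ρ).exists_isMaxOn
    ⟨y, Metric.mem_closedBall_self hρ.le⟩
    (huc.add (continuous_const.mul hh2.continuous).continuousOn :
      ContinuousOn w (Metric.closedBall y ρ))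
  have hwy : u y ≤ w z := by
    have := hzmax (Metric.mem_closedBall_self hρ.le)
    simpa [hw, hhy] using this
  have hzb : z ∈ Metric.ball y ρ := by
    rcases (Metric.mem_closedBall.1 hz).lt_or_eq with hc | hc
    · exact hc
    · exact absurd (hbd z hc) (not_lt.2 hwy)
  have hwmax : IsLocalMax w z := by
    filter_upwards [Metric.isOpen_ball.mem_nhds hzb] with x hx
    exact hzmax (Metric.ball_subset_closedBall hx)
  obtain ⟨h1, h2, -, -, h5, -⟩ := hball hz
  have hεh : ContDiff ℝ 2 fun z => ε * h z := contDiff_const.mul hh2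
  have hw2 : ContDiffAt ℝ 2 w z := h1.add hεh.contDiffAt
  have hfd : ∀ x, DifferentiableAt ℝ u x → fderiv ℝ w x = fderiv ℝ u x + ε • fderiv ℝ h x :=
    fun x hx => (hx.hasFDerivAt.add
      ((hh2.differentiable two_ne_zero x).hasFDerivAt.const_mul ε)).fderiv
  have hDu : fderiv ℝ u z = -(ε • fderiv ℝ h z) := by
    have := hfd z (h1.differentiableAt two_ne_zero)
    rw [hwmax.fderiv_eq_zero] at this
    exact eq_neg_of_add_eq_zero_left this.symm
  have hD2 : fderiv ℝ (fderiv ℝ w) z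
      = fderiv ℝ (fderiv ℝ u) z + ε • fderiv ℝ (fderiv ℝ h) z := by
    have he : fderiv ℝ w =ᶠ[𝓝 z] fun x => fderiv ℝ u x + ε • fderiv ℝ h x :=
      h1.eventually_differentiableAt.mono hfd
    rw [he.fderiv_eq]
    exact (h1.hasFDerivAt_fderiv.add (hh2.contDiffAt.hasFDerivAt_fderiv.const_smul ε)).fderiv
  have hsum : ∑ k, fderiv ℝ (fderiv ℝ u) z (X k z) (X k z)
      ≤ -ε * ∑ k, fderiv ℝ (fderiv ℝ h) z (X k z) (X k z) := by
    rw [Finset.mul_sum]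
    refine Finset.sum_le_sum fun k _ => ?_
    have := hwmax.fderiv_fderiv_apply_self_nonpos hw2 (X k z)
    rw [hD2] at this
    simp at this
    linarith
  have hn : ‖fderiv ℝ u z‖ = ε * ‖fderiv ℝ h z‖ := by
    rw [hDu, norm_neg, norm_smul, Real.norm_of_nonneg hε.le]
  have hm : max (-u z) 0 ≤ ε * max (h z) 0 := by
    refine max_le ?_ (by positivity)
    have : ε * h z ≤ ε * max (h z) 0 := by gcongr; exact le_max_left _ _
    simp only [hw] at hwy
    linarith
  have hm' := mul_le_mul_of_nonneg_left hm hC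
  rw [hn] at h2
  nlinarith

end SecondOrder

section Linearization

variable {N : ℕ}

theorem norm_ee_le_one (k : ℕ) : ‖ee N k‖ ≤ 1 := by
  refine (pi_norm_le_iff_of_nonneg zero_le_one).2 fun i => ?_
  unfold ee
  split_ifs <;> simp

theorem norm_grad_sub_grad_le (f g : (Fin N → ℝ) → ℝ) (x : Fin N → ℝ) :
    ‖grad N f x - grad N g x‖ ≤ ‖fderiv ℝ f x - fderiv ℝ g x‖ := by
  refine (pi_norm_le_iff_of_nonneg (norm_nonneg _)).2 fun i => ?_
  have h := (fderiv ℝ f x - fderiv ℝ g x).le_opNorm (ee N i)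
  have h1 := mul_le_mul_of_nonneg_left (norm_ee_le_one (N := N) i)
    (norm_nonneg (fderiv ℝ f x - fderiv ℝ g x))
  simpa [grad, pd] using h.trans h1

theorem pd_pd_eq {f : (Fin N → ℝ) → ℝ} {x : Fin N → ℝ} (hf : ContDiffAt ℝ 2 f x) (i j : ℕ) :
    pd N i (pd N j f) x = fderiv ℝ (fderiv ℝ f) x (ee N i) (ee N j) := by
  have h := hf.hasFDerivAt_fderiv.clm_apply (hasFDerivAt_const (ee N j) x)
  refine (congrArg (fun T => T (ee N i)) h.fderiv).trans ?_
  simp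

theorem continuousAt_grad {f : (Fin N → ℝ) → ℝ} {x : Fin N → ℝ} (hf : ContDiffAt ℝ 2 f x) :
    ContinuousAt (grad N f) x :=
  continuousAt_pi.2 fun _ => hf.hasFDerivAt_fderiv.continuousAt.clm_apply continuousAt_const

/-- A decomposition `∑ A_ij ∂_i ∂_j = ∑ X_k² + Y` identifies the principal symbol. -/
theorem sum_mul_bilin_eq_of_sum_sq {r : ℕ} {A : Matrix (Fin N) (Fin N) ℝ}
    {X : Fin r → (Fin N → ℝ) → (Fin N → ℝ)} {Y : (Fin N → ℝ) → (Fin N → ℝ)} {x : Fin N → ℝ}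
    (hX : ∀ k, DifferentiableAt ℝ (X k) x)
    (hdecomp : ∀ f : (Fin N → ℝ) → ℝ, ContDiff ℝ 2 f →
      (∑ i, ∑ j, A i j * pd N i (pd N j f) x) = (∑ k, vApp (X k) (vApp (X k) f) x) + vApp Y f x)
    {B : (Fin N → ℝ) →L[ℝ] (Fin N → ℝ) →L[ℝ] ℝ} (hB : ∀ v w, B v w = B w v) :
    ∑ i, ∑ j, A i j * B (ee N i) (ee N j) = ∑ k, B (X k x) (X k x) := by
  have hsub : ∀ z, HasFDerivAt (fun z : Fin N → ℝ => z - x)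
      (ContinuousLinearMap.id ℝ (Fin N → ℝ)) z := fun z => (hasFDerivAt_id z).sub_const x
  have hBsub : ∀ z, HasFDerivAt (fun z : Fin N → ℝ => B (z - x)) B z := fun z => by
    have h := B.hasFDerivAt.comp z (hsub z)
    rwa [ContinuousLinearMap.comp_id] at h
  have hf : ContDiff ℝ 2 fun z => B (z - x) (z - x) := by fun_prop
  have hD : fderiv ℝ (fun z => B (z - x) (z - x)) = fun z => (2 : ℝ) • B (z - x) := by
    funext z
    ext v
    rw [((hBsub z).clm_apply (hsub z)).fderiv]
    have := hB v (z - x)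
    simp only [map_sub, _root_.sub_apply] at this
    simp
    linarith
  have hpd : ∀ i j : ℕ, pd N i (pd N j fun z => B (z - x) (z - x)) x
      = 2 * B (ee N i) (ee N j) := fun i j => by
    rw [pd_pd_eq hf.contDiffAt, hD]
    refine (congrArg (fun T => T (ee N i) (ee N j))
      ((hBsub x).const_smul (2 : ℝ)).fderiv).trans ?_
    simp
  have hvv : ∀ k, vApp (X k) (vApp (X k) fun z => B (z - x) (z - x)) x
      = 2 * B (X k x) (X k x) := fun k => by
    have h := ((hBsub x).const_smul (2 : ℝ)).clm_apply (hX k).hasFDerivAt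
    unfold vApp
    rw [hD]
    refine (congrArg (fun T => T (X k x)) h.fderiv).trans ?_
    simp
  have hv : vApp Y (fun z => B (z - x) (z - x)) x = 0 := by
    rw [vApp, hD]
    simp
  have := hdecomp _ hf
  simp only [hpd, hvv, hv, add_zero, mul_left_comm _ (2 : ℝ), ← Finset.mul_sum] at this
  linarith

theorem ContDiffAt.isBigO_comp_sub_comp {E F : Type*} [NormedAddCommGroup E] [NormedSpace ℝ E]
    [NormedAddCommGroup F] [NormedSpace ℝ F] {α : Type*} {l : Filter α} {f : E → F} {p : E}
    (hf : ContDiffAt ℝ 1 f p) {u v : α → E} (hu : Tendsto u l (𝓝 p)) (hv : Tendsto v l (𝓝 p)) :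
    (fun z => f (u z) - f (v z)) =O[l] fun z => u z - v z :=
  (hf.hasStrictFDerivAt one_ne_zero).isBigO_sub.comp_tendsto (hu.prodMk_nhds hv)

/-- Near a nonnegative local maximum of `φ - ψ`, the inequality `Qψ ≤ Qφ` linearizes to a second
order differential inequality for `φ - ψ`. -/
theorem exists_linearized_inequality {Ω : Set (Fin N → ℝ)} (hΩ : IsOpen Ω)
    {a : (Fin N → ℝ) → (Fin N → ℝ) → Matrix (Fin N) (Fin N) ℝ}
    {b : (Fin N → ℝ) → ℝ → (Fin N → ℝ) → ℝ}
    (ha : ∀ i j, ContDiffOn ℝ (⊤ : ℕ∞) (fun q : (Fin N → ℝ) × (Fin N → ℝ) => a q.1 q.2 i j)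
      (Ω ×ˢ (Set.univ : Set (Fin N → ℝ))))
    (hb : ContDiffOn ℝ (⊤ : ℕ∞) (fun q : (Fin N → ℝ) × ℝ × (Fin N → ℝ) => b q.1 q.2.1 q.2.2)
      (Ω ×ˢ (Set.univ : Set (ℝ × (Fin N → ℝ)))))
    {φ ψ : (Fin N → ℝ) → ℝ}
    (hφ : ContDiffOn ℝ (⊤ : ℕ∞) φ Ω) (hψ : ContDiffOn ℝ (⊤ : ℕ∞) ψ Ω)
    (hQ : ∀ x ∈ Ω, Qop N a b ψ x ≤ Qop N a b φ x)
    (hbz : ∀ x z p, deriv (fun t : ℝ => b x t p) z ≤ 0)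
    {r : ℕ} {X : Fin r → (Fin N → ℝ) → (Fin N → ℝ)} {Y : (Fin N → ℝ) → (Fin N → ℝ)}
    (hX : ∀ k, ContDiffOn ℝ (⊤ : ℕ∞) (X k) Ω)
    (hdecomp : ∀ f : (Fin N → ℝ) → ℝ, ContDiff ℝ 2 f → ∀ x ∈ Ω,
      (∑ i, ∑ j, a x (grad N φ x) i j * pd N i (pd N j f) x)
        = (∑ k, vApp (X k) (vApp (X k) f) x) + vApp Y f x)
    {y : Fin N → ℝ} (hy : y ∈ Ω) (hmax : IsLocalMax (fun z => φ z - ψ z) y)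
    (hnn : 0 ≤ φ y - ψ y) :
    ∃ C : ℝ, 0 ≤ C ∧ ∀ᶠ z in 𝓝 y,
      0 ≤ ∑ k, fderiv ℝ (fderiv ℝ fun z => φ z - ψ z) z (X k z) (X k z)
        + C * ‖fderiv ℝ (fun z => φ z - ψ z) z‖ + C * max (-(φ z - ψ z)) 0 := by
  have hφ2 : ∀ z ∈ Ω, ContDiffAt ℝ 2 φ z := fun z hz =>
    (hφ.contDiffAt (hΩ.mem_nhds hz)).of_le (WithTop.coe_le_coe.2 (le_top (a := (2 : ℕ∞))))
  have hψ2 : ∀ z ∈ Ω, ContDiffAt ℝ 2 ψ z := fun z hz =>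
    (hψ.contDiffAt (hΩ.mem_nhds hz)).of_le (WithTop.coe_le_coe.2 (le_top (a := (2 : ℕ∞))))
  have hfd : ∀ z ∈ Ω, fderiv ℝ (fun z => φ z - ψ z) z = fderiv ℝ φ z - fderiv ℝ ψ z :=
    fun z hz => fderiv_fun_sub ((hφ2 z hz).differentiableAt two_ne_zero)
      ((hψ2 z hz).differentiableAt two_ne_zero)
  have hu2 : ∀ z ∈ Ω, ContDiffAt ℝ 2 (fun z => φ z - ψ z) z := fun z hz =>
    (hφ2 z hz).sub (hψ2 z hz)
  have hgrad : grad N φ y = grad N ψ y := by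
    have h0 := hmax.fderiv_eq_zero
    have h1 := norm_grad_sub_grad_le φ ψ y
    rw [← hfd y hy, h0, norm_zero] at h1
    exact sub_eq_zero.1 (norm_le_zero_iff.1 h1)
  have cφ : Tendsto (grad N φ) (𝓝 y) (𝓝 (grad N φ y)) := continuousAt_grad (hφ2 y hy)
  have cψ : Tendsto (grad N ψ) (𝓝 y) (𝓝 (grad N φ y)) := hgrad ▸ continuousAt_grad (hψ2 y hy)
  have c0φ : Tendsto φ (𝓝 y) (𝓝 (φ y)) := (hφ2 y hy).continuousAt
  have c0ψ : Tendsto ψ (𝓝 y) (𝓝 (ψ y)) := (hψ2 y hy).continuousAt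
  have hbat : ∀ t p, ∀ z ∈ Ω, ContDiffAt ℝ 1
      (fun q : (Fin N → ℝ) × ℝ × (Fin N → ℝ) => b q.1 q.2.1 q.2.2) (z, t, p) := fun t p z hz =>
    (hb.contDiffAt ((hΩ.prod isOpen_univ).mem_nhds ⟨hz, mem_univ _⟩)).of_le
      (by exact_mod_cast le_top)
  have hO : (fun z => (∑ i, ∑ j, (a z (grad N φ z) i j - a z (grad N ψ z) i j) *
        fderiv ℝ (fderiv ℝ ψ) z (ee N i) (ee N j))
      + (b z (φ z) (grad N φ z) - b z (φ z) (grad N ψ z)))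
      =O[𝓝 y] fun z => fderiv ℝ (fun z => φ z - ψ z) z := by
    have hg : (fun z => grad N φ z - grad N ψ z)
        =O[𝓝 y] fun z => fderiv ℝ (fun z => φ z - ψ z) z := by
      refine Asymptotics.IsBigO.of_bound 1 ?_
      filter_upwards [hΩ.mem_nhds hy] with z hz
      rw [one_mul, hfd z hz]
      exact norm_grad_sub_grad_le φ ψ z
    refine Asymptotics.IsBigO.add (Asymptotics.IsBigO.fun_sum fun i _ =>
      Asymptotics.IsBigO.fun_sum fun j _ => ?_) ?_
    · have h1 : ContDiffAt ℝ 1 (fun q : (Fin N → ℝ) × (Fin N → ℝ) => a q.1 q.2 i j)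
          (y, grad N φ y) :=
        ((ha i j).contDiffAt ((hΩ.prod isOpen_univ).mem_nhds ⟨hy, mem_univ _⟩)).of_le
          (by exact_mod_cast le_top)
      have h2 := (h1.isBigO_comp_sub_comp (tendsto_id.prodMk_nhds cφ)
        (tendsto_id.prodMk_nhds cψ)).trans
        (Asymptotics.isBigO_of_le (g := fun z => grad N φ z - grad N ψ z) _ fun z => by simp)
      have h3 : (fun z => fderiv ℝ (fderiv ℝ ψ) z (ee N i) (ee N j)) =O[𝓝 y]
          fun _ => (1 : ℝ) := by
        have h4 : ContinuousAt (fderiv ℝ (fderiv ℝ ψ)) y :=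
          ((((hψ2 y hy).fderiv_right (m := 1) (by norm_num)).fderiv_right (m := 0)
            (by norm_num))).continuousAt
        exact ((h4.clm_apply continuousAt_const).clm_apply continuousAt_const).tendsto.isBigO_one ℝ
      have h5 := (h2.trans hg).norm_right.mul h3
      simp only [mul_one] at h5
      exact h5.of_norm_right
    · have h2 := ((hbat (φ y) (grad N φ y) y hy).isBigO_comp_sub_comp
        (tendsto_id.prodMk_nhds (c0φ.prodMk_nhds cφ))
        (tendsto_id.prodMk_nhds (c0φ.prodMk_nhds cψ))).trans
        (Asymptotics.isBigO_of_le (g := fun z => grad N φ z - grad N ψ z) _ fun z => by simp)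
      exact h2.trans hg
  obtain ⟨C₁, hC₁, hO₁⟩ := hO.exists_nonneg
  have hanti : ∀ z ∈ Ω, ∀ p, Antitone fun t => b z t p := fun z hz p =>
    antitone_of_deriv_nonpos (fun t => by
      have h1 := (hbat t p z hz).differentiableAt one_ne_zero
      have h2 : DifferentiableAt ℝ (fun t : ℝ => ((z, t, p) : (Fin N → ℝ) × ℝ × (Fin N → ℝ))) t :=
        by fun_prop
      exact DifferentiableAt.comp t h1 h2) fun t => hbz z t p
  obtain ⟨C₂, hC₂, hO₂⟩ : ∃ C : ℝ, 0 ≤ C ∧ ∀ᶠ z in 𝓝 y,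
      b z (φ z) (grad N ψ z) - b z (ψ z) (grad N ψ z) ≤ C * max (-(φ z - ψ z)) 0 := by
    rcases hnn.lt_or_eq with hpos | hzero
    · refine ⟨0, le_rfl, ?_⟩
      filter_upwards [(c0φ.sub c0ψ).eventually_const_lt hpos, hΩ.mem_nhds hy] with z hz hzΩ
      have := hanti z hzΩ (grad N ψ z) (sub_pos.1 hz).le
      simp only at this
      linarith
    · have heq : ψ y = φ y := by linarith
      rw [heq] at c0ψ
      have h2 := ((hbat (φ y) (grad N φ y) y hy).isBigO_comp_sub_comp
        (tendsto_id.prodMk_nhds (c0φ.prodMk_nhds cψ))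
        (tendsto_id.prodMk_nhds (c0ψ.prodMk_nhds cψ))).trans
        (Asymptotics.isBigO_of_le (g := fun z => φ z - ψ z) _ fun z => by simp)
      obtain ⟨C, hC, hO⟩ := h2.exists_nonneg
      refine ⟨C, hC, ?_⟩
      filter_upwards [hO.bound, hΩ.mem_nhds hy] with z hz hzΩ
      rcases le_total 0 (φ z - ψ z) with h | h
      · have h3 := hanti z hzΩ (grad N ψ z) (sub_nonneg.1 h)
        have h4 : 0 ≤ C * max (-(φ z - ψ z)) 0 := mul_nonneg hC (le_max_right _ _)
        simp only at h3
        linarith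
      · rw [max_eq_left (by linarith), ← abs_of_nonpos h]
        exact (le_abs_self _).trans hz
  refine ⟨max C₁ C₂, hC₁.trans (le_max_left _ _), ?_⟩
  filter_upwards [hO₁.bound, hO₂, hΩ.mem_nhds hy] with z h1 h2 hz
  have hQz := hQ z hz
  have hH : fderiv ℝ (fderiv ℝ fun z => φ z - ψ z) z
      = fderiv ℝ (fderiv ℝ φ) z - fderiv ℝ (fderiv ℝ ψ) z := by
    have he : fderiv ℝ (fun z => φ z - ψ z) =ᶠ[𝓝 z] fun x => fderiv ℝ φ x - fderiv ℝ ψ x := by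
      filter_upwards [hΩ.mem_nhds hz] with x hx using hfd x hx
    rw [he.fderiv_eq]
    exact ((hφ2 z hz).hasFDerivAt_fderiv.sub (hψ2 z hz).hasFDerivAt_fderiv).fderiv
  have hsymm : ∀ v w, fderiv ℝ (fderiv ℝ fun z => φ z - ψ z) z v w
      = fderiv ℝ (fderiv ℝ fun z => φ z - ψ z) z w v := fun v w =>
    ((hu2 z hz).isSymmSndFDerivAt (by simp)).eq v w
  have hprin := sum_mul_bilin_eq_of_sum_sq (A := a z (grad N φ z)) (Y := Y)
    (fun k => ((hX k).contDiffAt (hΩ.mem_nhds hz)).differentiableAt (by simp))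
    (fun f hf => hdecomp f hf z hz) hsymm
  rw [← hprin, hH]
  simp only [Qop, pd_pd_eq (hφ2 z hz), pd_pd_eq (hψ2 z hz)] at hQz
  have h1' := (le_abs_self _).trans h1
  have hm1 := mul_le_mul_of_nonneg_right (le_max_left C₁ C₂)
    (norm_nonneg (fderiv ℝ (fun z => φ z - ψ z) z))
  have hm2 := mul_le_mul_of_nonneg_right (le_max_right C₁ C₂)
    (le_max_right (-(φ z - ψ z)) 0)
  simp only [_root_.sub_apply, sub_mul, mul_sub, Finset.sum_sub_distrib] at h1' ⊢
  linarith

end Linearization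

section Invariance

variable {N : ℕ}

theorem abs_dotProduct_le (v w : Fin N → ℝ) : |v ⬝ᵥ w| ≤ N * (‖v‖ * ‖w‖) := by
  refine (Finset.abs_sum_le_sum_abs _ _).trans ?_
  have : ∀ i ∈ (Finset.univ : Finset (Fin N)), |v i * w i| ≤ ‖v‖ * ‖w‖ := fun i _ => by
    rw [abs_mul]
    exact mul_le_mul (norm_le_pi_norm v i) (norm_le_pi_norm w i) (abs_nonneg _) (norm_nonneg _)
  simpa using Finset.sum_le_sum this

theorem norm_sq_le_dotProduct_self (v : Fin N → ℝ) : ‖v‖ ^ 2 ≤ v ⬝ᵥ v := by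
  have h0 : 0 ≤ v ⬝ᵥ v := Finset.sum_nonneg fun i _ => mul_self_nonneg _
  have h1 : ‖v‖ ≤ √(v ⬝ᵥ v) := (pi_norm_le_iff_of_nonneg (Real.sqrt_nonneg _)).2 fun i => by
    refine Real.abs_le_sqrt ?_
    rw [sq]
    exact Finset.single_le_sum (f := fun i => v i * v i) (fun i _ => mul_self_nonneg _)
      (Finset.mem_univ i)
  exact (pow_le_pow_left₀ (norm_nonneg _) h1 2).trans_eq (Real.sq_sqrt h0)

theorem dist_toLp_sq (x y : Fin N → ℝ) :
    dist (WithLp.toLp 2 x) (WithLp.toLp 2 y) ^ 2 = (x - y) ⬝ᵥ (x - y) := by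
  rw [EuclideanSpace.dist_eq, Real.sq_sqrt (Finset.sum_nonneg fun i _ => sq_nonneg _)]
  simp [dotProduct, Real.dist_eq, sq]

theorem hasDerivAt_dotProduct_self {c : ℝ → Fin N → ℝ} {c' : Fin N → ℝ} {s : ℝ}
    (hc : HasDerivAt c c' s) (p : Fin N → ℝ) :
    HasDerivAt (fun z => (c z - p) ⬝ᵥ (c z - p)) (2 * ((c s - p) ⬝ᵥ c')) s := by
  have h := HasDerivAt.fun_sum (u := Finset.univ) fun i _ =>
    (((hasDerivAt_pi.1 hc i).sub_const (p i)).mul ((hasDerivAt_pi.1 hc i).sub_const (p i)))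
  refine h.congr_deriv ?_
  rw [dotProduct, Finset.mul_sum]
  refine Finset.sum_congr rfl fun i _ => ?_
  simp
  ring

/-- Quantitative invariance: if `X` is Lipschitz and tangent to the locally closed set `F`, a curve
starting in `F` which solves `c' = X(c)` up to an error `η` stays within `O(ηT)` of `F`. -/
theorem TangentTo.exists_near {F : Set (Fin N → ℝ)} {X : (Fin N → ℝ) → (Fin N → ℝ)}
    (hT : TangentTo F X) {y : Fin N → ℝ} {ρ : ℝ} (hy : y ∈ F)
    (hF : IsCompact (F ∩ Metric.closedBall y ρ)) {L : NNReal}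
    (hX : LipschitzOnWith L X (Metric.closedBall y ρ)) {c c' : ℝ → Fin N → ℝ} {T η : ℝ}
    (hT0 : 0 < T) (hc : ∀ s ∈ Icc 0 T, HasDerivAt c (c' s) s)
    (hcb : ∀ s ∈ Icc 0 T, (N + 2) * ‖c s - y‖ < ρ)
    (hcη : ∀ s ∈ Icc 0 T, ‖c' s - X (c s)‖ ≤ η) (h0 : c 0 ∈ F) :
    ∃ p ∈ F ∩ Metric.closedBall y ρ,
      ‖c T - p‖ ^ 2 ≤ (N * η * T) ^ 2 * Real.exp (1 + 2 * N * L * T) := by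
  have hρ : 0 < ρ := (by positivity : 0 ≤ (N + 2) * ‖c 0 - y‖).trans_lt (hcb 0 ⟨le_rfl, hT0.le⟩)
  have hyS : y ∈ F ∩ Metric.closedBall y ρ := ⟨hy, Metric.mem_closedBall_self hρ.le⟩
  set S' : Set (EuclideanSpace ℝ (Fin N)) := WithLp.toLp 2 '' (F ∩ Metric.closedBall y ρ) with hS'
  have hS'c : IsCompact S' := hF.image (PiLp.continuous_toLp 2 _)
  have hS'n : S'.Nonempty := ⟨_, y, hyS, rfl⟩
  set D : ℝ → ℝ := fun s => Metric.infDist (WithLp.toLp 2 (c s)) S' ^ 2 with hD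
  have hDle : ∀ s, ∀ p ∈ F ∩ Metric.closedBall y ρ, D s ≤ (c s - p) ⬝ᵥ (c s - p) := by
    intro s p hp
    rw [← dist_toLp_sq]
    exact pow_le_pow_left₀ Metric.infDist_nonneg
      (Metric.infDist_le_dist_of_mem (Set.mem_image_of_mem _ hp)) 2
  have hmin : ∀ s, ∃ p ∈ F ∩ Metric.closedBall y ρ, D s = (c s - p) ⬝ᵥ (c s - p) := by
    intro s
    obtain ⟨_, ⟨p, hp, rfl⟩, hd⟩ := hS'c.exists_infDist_eq_dist hS'n (WithLp.toLp 2 (c s))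
    exact ⟨p, hp, by rw [← dist_toLp_sq, ← hd]⟩
  choose p hpS hpD using hmin
  have hnorm : ∀ s, ‖c s - p s‖ ^ 2 ≤ D s := fun s => by
    rw [hpD]
    exact norm_sq_le_dotProduct_self _
  have hperp : ∀ s ∈ Icc 0 T, (c s - p s) ⬝ᵥ X (p s) = 0 := by
    intro s hs
    refine hT _ (hpS s).1 _ ?_
    have hlt : ‖p s - y‖ < ρ := by
      have h1 : ‖c s - p s‖ ^ 2 ≤ ((N + 1) * ‖c s - y‖) ^ 2 := by
        refine ((hnorm s).trans (hDle s y hyS)).trans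
          (((le_abs_self _).trans (abs_dotProduct_le _ _)).trans ?_)
        have : (0 : ℝ) ≤ N := N.cast_nonneg
        nlinarith [mul_self_nonneg ‖c s - y‖, mul_nonneg this (mul_self_nonneg ‖c s - y‖),
          mul_nonneg (mul_nonneg this this) (mul_self_nonneg ‖c s - y‖)]
      have h2 := le_of_abs_le (abs_le_of_sq_le_sq h1 (by positivity))
      have h3 := norm_sub_le_norm_sub_add_norm_sub (p s) (c s) y
      rw [norm_sub_rev (p s) (c s)] at h3
      linarith [hcb s hs]
    filter_upwards [Metric.isOpen_ball.mem_nhds (mem_ball_iff_norm.2 hlt)] with x hx hxF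
    rw [← hpD]
    exact hDle s x ⟨hxF, Metric.ball_subset_closedBall hx⟩
  have hcont : ContinuousOn D (Icc 0 T) := fun s hs =>
    (((Metric.continuous_infDist_pt S').comp (PiLp.continuous_toLp 2 _)).continuousAt.comp
      (hc s hs).continuousAt).pow 2 |>.continuousWithinAt
  have hN : (0 : ℝ) ≤ N := N.cast_nonneg
  have hK : 0 < T⁻¹ + 2 * N * L := by positivity
  have hgron := le_gronwallBound_of_liminf_deriv_right_le (f := D)
    (f' := fun s => 2 * ((c s - p s) ⬝ᵥ c' s)) (δ := 0) (K := T⁻¹ + 2 * N * L)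
    (ε := (N * η) ^ 2 * T) hcont ?_ ?_ ?_ T ⟨hT0.le, le_rfl⟩
  · refine ⟨p T, hpS T, ((hnorm T).trans hgron).trans ?_⟩
    rw [gronwallBound_of_K_ne_0 hK.ne']
    have he : (T⁻¹ + 2 * N * L) * (T - 0) = 1 + 2 * N * L * T := by field_simp; ring
    simp only [he, zero_mul, zero_add]
    have h1 : (N * η) ^ 2 * T / (T⁻¹ + 2 * N * L) ≤ (N * η * T) ^ 2 := by
      rw [div_le_iff₀ hK]
      have : (N * η * T) ^ 2 * (T⁻¹ + 2 * N * L)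
          = (N * η) ^ 2 * T + (N * η * T) ^ 2 * (2 * N * L) := by field_simp
      rw [this]
      have : 0 ≤ (N * η * T) ^ 2 * (2 * N * L) := by positivity
      linarith
    have h2 : 0 ≤ Real.exp (1 + 2 * N * L * T) - 1 := by
      have := Real.one_le_exp (x := 1 + 2 * N * L * T) (by positivity)
      linarith
    calc _ ≤ (N * η * T) ^ 2 * (Real.exp (1 + 2 * N * L * T) - 1) :=
          mul_le_mul_of_nonneg_right h1 h2
      _ ≤ _ := by gcongr; linarith
  · intro s hs r hr
    have hq := hasDerivAt_dotProduct_self (hc s (Ico_subset_Icc_self hs)) (p s)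
    have hev := ((hasDerivAt_iff_tendsto_slope.1 hq).mono_left
      (nhdsWithin_mono s fun z (hz : s < z) => hz.ne')).eventually_lt_const hr
    refine Eventually.frequently ?_
    filter_upwards [hev, self_mem_nhdsWithin] with z hz hsz
    refine lt_of_le_of_lt ?_ hz
    rw [slope_def_field, hpD s, div_eq_inv_mul]
    have : 0 ≤ (z - s)⁻¹ := inv_nonneg.2 (sub_nonneg.2 (le_of_lt hsz))
    gcongr
    exact hDle z _ (hpS s)
  · have := hDle 0 (c 0) ⟨h0, ?_⟩
    · simpa using this
    · have h1 := hcb 0 ⟨le_rfl, hT0.le⟩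
      refine mem_closedBall_iff_norm.2 ?_
      nlinarith [norm_nonneg (c 0 - y)]
  · intro s hs
    have hs' := Ico_subset_Icc_self hs
    have hsplit : (c s - p s) ⬝ᵥ c' s = (c s - p s) ⬝ᵥ (c' s - X (c s))
        + (c s - p s) ⬝ᵥ (X (c s) - X (p s)) := by
      simp only [dotProduct_sub, hperp s hs']
      ring
    have hcs : c s ∈ Metric.closedBall y ρ := by
      have h1 := hcb s hs'
      refine mem_closedBall_iff_norm.2 ?_
      nlinarith [norm_nonneg (c s - y)]
    have h1 : (c s - p s) ⬝ᵥ (c' s - X (c s)) ≤ N * (‖c s - p s‖ * η) :=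
      ((le_abs_self _).trans (abs_dotProduct_le _ _)).trans (by gcongr; exact hcη s hs')
    have h2 : (c s - p s) ⬝ᵥ (X (c s) - X (p s)) ≤ N * (‖c s - p s‖ * (L * ‖c s - p s‖)) :=
      ((le_abs_self _).trans (abs_dotProduct_le _ _)).trans
        (by gcongr; exact hX.norm_sub_le hcs (hpS s).2)
    have h3 : 2 * (N * (‖c s - p s‖ * η)) ≤ T⁻¹ * ‖c s - p s‖ ^ 2 + (N * η) ^ 2 * T := by
      have : T⁻¹ * ‖c s - p s‖ ^ 2 + (N * η) ^ 2 * T - 2 * (N * (‖c s - p s‖ * η))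
          = T⁻¹ * (‖c s - p s‖ - N * η * T) ^ 2 := by field_simp; ring
      have h4 : 0 ≤ T⁻¹ * (‖c s - p s‖ - N * η * T) ^ 2 := by positivity
      linarith
    have h5 : (T⁻¹ + 2 * N * L) * ‖c s - p s‖ ^ 2 ≤ (T⁻¹ + 2 * N * L) * D s := by
      gcongr; exact hnorm s
    rw [hsplit]
    nlinarith

end Invariance

section Brackets

variable {N : ℕ} {F : Set (Fin N → ℝ)} {X Y : (Fin N → ℝ) → (Fin N → ℝ)} {y : Fin N → ℝ}

theorem sub_dotProduct_self (v w : Fin N → ℝ) :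
    (v - w) ⬝ᵥ (v - w) = v ⬝ᵥ v - 2 * (v ⬝ᵥ w) + w ⬝ᵥ w := by
  simp only [sub_dotProduct, dotProduct_sub, dotProduct_comm w v]
  ring

theorem TangentTo.neg (hT : TangentTo F X) : TangentTo F (-X) := fun p hp c hc => by
  rw [Pi.neg_apply, dotProduct_neg, hT p hp c hc, neg_zero]

theorem exists_isCompact_inter_closedBall_lipschitzOnWith
    (hF : ∃ ρ > 0, IsCompact (F ∩ Metric.closedBall y ρ)) (hX : ContDiffAt ℝ 1 X y) :
    ∃ ρ > 0, IsCompact (F ∩ Metric.closedBall y ρ) ∧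
      ∃ L : NNReal, LipschitzOnWith L X (Metric.closedBall y ρ) := by
  obtain ⟨ρ₁, hρ₁, hc⟩ := hF
  obtain ⟨L, t, ht, hL⟩ := hX.exists_lipschitzOnWith
  obtain ⟨ρ₂, hρ₂, hsub⟩ := Metric.nhds_basis_closedBall.mem_iff.1 ht
  refine ⟨min ρ₁ ρ₂, lt_min hρ₁ hρ₂, ?_, L, hL.mono
    ((Metric.closedBall_subset_closedBall (min_le_right _ _)).trans hsub)⟩
  have h : F ∩ Metric.closedBall y (min ρ₁ ρ₂)
      = (F ∩ Metric.closedBall y ρ₁) ∩ Metric.closedBall y (min ρ₁ ρ₂) := by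
    rw [inter_assoc, inter_eq_self_of_subset_right
      (Metric.closedBall_subset_closedBall (min_le_left ρ₁ ρ₂))]
  rw [h]
  exact hc.inter_right Metric.isClosed_closedBall

set_option maxHeartbeats 1000000 in
/-- Flowing a second order jet of a family of points of `F` along a field tangent to `F`. -/
theorem TangentTo.exists_jet (hT : TangentTo F X) (hy : y ∈ F)
    (hF : ∃ ρ > 0, IsCompact (F ∩ Metric.closedBall y ρ)) (hX : ContDiffAt ℝ 1 X y)
    {A : (Fin N → ℝ) →L[ℝ] (Fin N → ℝ)} (hA : HasFDerivAt X A y)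
    {v a : Fin N → ℝ} {x : ℝ → Fin N → ℝ} (hxF : ∀ᶠ t in 𝓝[>] 0, x t ∈ F)
    (hx : (fun t => x t - (y + t • v + t ^ 2 • a)) =o[𝓝[>] 0] fun t : ℝ => t ^ 2) :
    ∃ x' : ℝ → Fin N → ℝ, (∀ᶠ t in 𝓝[>] 0, x' t ∈ F) ∧
      (fun t => x' t - (y + t • (v + X y) + t ^ 2 • (a + A v + (1 / 2 : ℝ) • A (X y))))
        =o[𝓝[>] 0] fun t : ℝ => t ^ 2 := by
  obtain ⟨ρ, hρ, hcpt, L, hL⟩ := exists_isCompact_inter_closedBall_lipschitzOnWith hF hX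
  have hproj : ∀ z, ∃ p ∈ F ∩ Metric.closedBall y ρ, ∀ p' ∈ F ∩ Metric.closedBall y ρ,
      ‖z - p‖ ≤ ‖z - p'‖ := by
    intro z
    obtain ⟨p, hp, hd⟩ :=
      hcpt.exists_infDist_eq_dist ⟨y, hy, Metric.mem_closedBall_self hρ.le⟩ z
    refine ⟨p, hp, fun p' hp' => ?_⟩
    rw [← dist_eq_norm, ← dist_eq_norm, ← hd]
    exact Metric.infDist_le_dist_of_mem hp'
  choose π hπS hπ using hproj
  set e : ℝ → Fin N → ℝ := fun t => x t + t • X y + t ^ 2 • (A v + (1 / 2 : ℝ) • A (X y)) with he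
  refine ⟨fun t => π (e t), Eventually.of_forall fun t => (hπS _).1, ?_⟩
  suffices h : (fun t => e t - π (e t)) =o[𝓝[>] 0] fun t : ℝ => t ^ 2 by
    refine (hx.sub h).congr_left fun t => ?_
    simp only [he]
    module
  have hsmall : ∀ C d : ℝ, 0 < d → ∀ᶠ t in 𝓝[>] (0 : ℝ), C * t < d := fun C d hd => by
    have : ContinuousAt (fun t : ℝ => C * t) 0 := by fun_prop
    exact (this.eventually_lt_const (by simpa using hd)).filter_mono nhdsWithin_le_nhds
  obtain ⟨M, hM, hw⟩ : ∃ M : ℝ, 0 ≤ M ∧ ∀ᶠ t in 𝓝[>] (0 : ℝ), ‖x t - y - t • v‖ ≤ M * t ^ 2 := by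
    refine ⟨1 + ‖a‖, by positivity, ?_⟩
    filter_upwards [hx.bound one_pos] with t ht
    have h1 : x t - y - t • v = (x t - (y + t • v + t ^ 2 • a)) + t ^ 2 • a := by module
    rw [h1]
    refine (norm_add_le _ _).trans ?_
    rw [norm_smul, Real.norm_of_nonneg (sq_nonneg t)]
    rw [Real.norm_of_nonneg (sq_nonneg t)] at ht
    linarith
  set G : ℝ := ‖A v‖ + ‖A (X y)‖ with hG
  set P : ℝ := M + (‖v‖ + ‖X y‖) + G with hP
  have hG0 : 0 ≤ G := by positivity
  have hP0 : 0 ≤ P := by positivity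
  have hNn : (0 : ℝ) ≤ N := N.cast_nonneg
  refine Asymptotics.IsLittleO.of_bound fun ε hε => ?_
  set E : ℝ := Real.exp (1 + 2 * N * L) with hE
  have hE1 : 1 ≤ E := Real.one_le_exp (by positivity)
  set ε₁ : ℝ := ε / ((N + 1) * E) with hε₁
  have hε₁0 : 0 < ε₁ := by positivity
  have hε₁' : ε₁ * ((N + 1) * E) = ε := div_mul_cancel₀ _ (by positivity)
  have hlin : ∀ᶠ z in 𝓝 y, ‖X z - X y - A (z - y)‖ ≤ ε₁ / (2 * (P + 1)) * ‖z - y‖ :=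
    hA.isLittleO.bound (by positivity)
  obtain ⟨δ, hδ, hball⟩ := Metric.nhds_basis_ball.eventually_iff.1 hlin
  filter_upwards [hw, hxF, self_mem_nhdsWithin, hsmall 1 1 one_pos, hsmall ((N + 2) * P) ρ hρ,
    hsmall P δ hδ, hsmall (2 * (‖A‖ * (M + G))) ε₁ hε₁0] with t hwt hxt ht0 ht1 htρ htδ htA
  have ht0' : (0 : ℝ) < t := ht0
  have ht1' : t ≤ 1 := by linarith
  set c : ℝ → Fin N → ℝ :=
    fun s => x t + s • X y + (s * t) • A v + (s ^ 2 / 2) • A (X y) with hc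
  set c' : ℝ → Fin N → ℝ := fun s => X y + t • A v + s • A (X y) with hc'
  have hcd : ∀ s, HasDerivAt c (c' s) s := fun s => by
    have h1 := (((hasDerivAt_id s).smul_const (X y)).const_add (x t)).add
      ((((hasDerivAt_id s).mul_const t)).smul_const (A v))
    have h2 := h1.add ((((hasDerivAt_id s).pow 2).div_const 2).smul_const (A (X y)))
    refine h2.congr_deriv ?_
    simp [hc']
  have hq : ∀ s ∈ Icc 0 t, ‖(s * t) • A v + (s ^ 2 / 2) • A (X y)‖ ≤ G * t ^ 2 := by
    intro s hs
    have h1 : s * t ≤ t ^ 2 := by nlinarith [hs.1, hs.2]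
    have h2 : s ^ 2 / 2 ≤ t ^ 2 := by nlinarith [hs.1, hs.2]
    have h3 : 0 ≤ s * t := mul_nonneg hs.1 ht0'.le
    refine (norm_add_le _ _).trans ?_
    rw [norm_smul, norm_smul, Real.norm_of_nonneg h3, Real.norm_of_nonneg (by positivity), hG,
      add_mul, mul_comm ‖A v‖, mul_comm ‖A (X y)‖]
    gcongr
  have hcy : ∀ s ∈ Icc 0 t, ‖c s - y‖ ≤ P * t := by
    intro s hs
    have h1 : c s - y = (x t - y - t • v) + (t • v + s • X y)
        + ((s * t) • A v + (s ^ 2 / 2) • A (X y)) := by simp only [hc]; module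
    have h2 : ‖t • v + s • X y‖ ≤ (‖v‖ + ‖X y‖) * t := by
      refine (norm_add_le _ _).trans ?_
      rw [norm_smul, norm_smul, Real.norm_of_nonneg ht0'.le, Real.norm_of_nonneg hs.1, add_mul,
        mul_comm ‖v‖, mul_comm ‖X y‖]
      gcongr
      exact hs.2
    have h3 : (M + G) * t ^ 2 ≤ (M + G) * t :=
      mul_le_mul_of_nonneg_left (by nlinarith) (by positivity)
    rw [h1]
    have h4 := norm_add₃_le (a := x t - y - t • v) (b := t • v + s • X y)
      (c := (s * t) • A v + (s ^ 2 / 2) • A (X y))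
    have h5 := hq s hs
    simp only [hP]
    nlinarith
  have hη : ∀ s ∈ Icc 0 t, ‖c' s - X (c s)‖ ≤ ε₁ * t := by
    intro s hs
    have hcs := hcy s hs
    have h1 := hball (mem_ball_iff_norm.2 (hcs.trans_lt htδ))
    have h2 : c' s - X (c s) = -(X (c s) - X y - A (c s - y))
        - A ((x t - y - t • v) + ((s * t) • A v + (s ^ 2 / 2) • A (X y))) := by
      have h3 : c s - y = ((x t - y - t • v) + ((s * t) • A v + (s ^ 2 / 2) • A (X y)))
          + (t • v + s • X y) := by simp only [hc]; module
      rw [h3, map_add A _ (t • v + s • X y), map_add A (t • v), map_smul, map_smul]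
      simp only [hc']
      module
    have h4 : ‖A ((x t - y - t • v) + ((s * t) • A v + (s ^ 2 / 2) • A (X y)))‖
        ≤ ‖A‖ * ((M + G) * t ^ 2) := by
      refine (A.le_opNorm _).trans ?_
      gcongr
      refine (norm_add_le _ _).trans ?_
      linarith [hq s hs]
    have h5 : ε₁ / (2 * (P + 1)) * ‖c s - y‖ ≤ ε₁ / 2 * t := by
      have h6 : ε₁ / (2 * (P + 1)) * ‖c s - y‖ ≤ ε₁ / (2 * (P + 1)) * ((P + 1) * t) := by
        gcongr
        nlinarith
      refine h6.trans_eq ?_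
      field_simp
    have h6 : ‖A‖ * ((M + G) * t ^ 2) ≤ ε₁ / 2 * t := by
      have h7 : ‖A‖ * (M + G) * t * t ≤ ε₁ / 2 * t :=
        mul_le_mul_of_nonneg_right (by linarith) ht0'.le
      exact (by ring : ‖A‖ * ((M + G) * t ^ 2) = ‖A‖ * (M + G) * t * t).trans_le h7
    rw [h2]
    refine (norm_sub_le _ _).trans ?_
    rw [norm_neg]
    linarith [h1.trans h5, h4.trans h6]
  have hcb : ∀ s ∈ Icc 0 t, (N + 2) * ‖c s - y‖ < ρ := by
    intro s hs
    refine lt_of_le_of_lt ?_ htρ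
    rw [mul_assoc]
    exact mul_le_mul_of_nonneg_left (hcy s hs) (by positivity)
  obtain ⟨p, hpS, hp⟩ := hT.exists_near hy hcpt hL ht0' (fun s _ => hcd s) hcb hη
    (by simpa [hc] using hxt)
  have hct : c t = e t := by simp only [hc, he]; module
  rw [hct] at hp
  refine (hπ _ p hpS).trans ?_
  rw [Real.norm_of_nonneg (sq_nonneg t)]
  refine le_of_abs_le (abs_le_of_sq_le_sq (hp.trans ?_) (by positivity))
  have h1 : Real.exp (1 + 2 * N * L * t) ≤ E := by
    refine Real.exp_le_exp.2 ?_
    have : 0 ≤ 2 * (N : ℝ) * L := by positivity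
    nlinarith
  calc (N * (ε₁ * t) * t) ^ 2 * Real.exp (1 + 2 * N * L * t)
      ≤ ((N + 1) * (ε₁ * t) * t) ^ 2 * E ^ 2 := by
        gcongr
        · linarith
        · exact h1.trans (by nlinarith)
    _ = (ε₁ * ((N + 1) * E) * t ^ 2) ^ 2 := by ring
    _ = _ := by rw [hε₁']

theorem TangentTo.dotProduct_lieBr_nonpos (hTX : TangentTo F X) (hTY : TangentTo F Y)
    (hy : y ∈ F) (hF : ∃ ρ > 0, IsCompact (F ∩ Metric.closedBall y ρ))
    (hX : ContDiffAt ℝ 1 X y) (hY : ContDiffAt ℝ 1 Y y) {c : Fin N → ℝ}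
    (hc : ∀ᶠ x in 𝓝 y, x ∈ F → (c - y) ⬝ᵥ (c - y) ≤ (c - x) ⬝ᵥ (c - x)) :
    (c - y) ⬝ᵥ lieBr X Y y ≤ 0 := by
  have hA := (hX.differentiableAt one_ne_zero).hasFDerivAt
  have hB := (hY.differentiableAt one_ne_zero).hasFDerivAt
  obtain ⟨x₁, hx₁F, hx₁⟩ := hTX.exists_jet hy hF hX hA (v := 0) (a := 0) (x := fun _ => y)
    (Eventually.of_forall fun _ => hy) (by simp)
  obtain ⟨x₂, hx₂F, hx₂⟩ := hTY.exists_jet hy hF hY hB hx₁F hx₁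
  obtain ⟨x₃, hx₃F, hx₃⟩ := hTX.neg.exists_jet hy hF hX.neg hA.neg hx₂F hx₂
  obtain ⟨x, hxF, hx⟩ := hTY.neg.exists_jet hy hF hY.neg hB.neg hx₃F hx₃
  set W : Fin N → ℝ := lieBr X Y y with hW
  have hx' : (fun t => x t - y - t ^ 2 • W) =o[𝓝[>] 0] fun t : ℝ => t ^ 2 := by
    refine hx.congr_left fun t => ?_
    simp only [hW, lieBr, Pi.neg_apply, map_add, map_neg, map_zero, _root_.neg_apply]
    module
  have hlim : Tendsto (fun t : ℝ => (t ^ 2)⁻¹ • (x t - y)) (𝓝[>] 0) (𝓝 W) := by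
    have h1 := hx'.tendsto_inv_smul_nhds_zero.add_const W
    rw [zero_add] at h1
    refine h1.congr' ?_
    filter_upwards [self_mem_nhdsWithin] with t (ht : 0 < t)
    rw [smul_sub, inv_smul_smul₀ (by positivity)]
    abel
  have hsq : Tendsto (fun t : ℝ => t ^ 2) (𝓝[>] 0) (𝓝 0) := by
    have : ContinuousAt (fun t : ℝ => t ^ 2) 0 := by fun_prop
    simpa using this.tendsto.mono_left nhdsWithin_le_nhds
  have hd : Tendsto (fun t => x t - y) (𝓝[>] 0) (𝓝 0) := by
    have h1 := hsq.smul hlim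
    rw [zero_smul] at h1
    refine h1.congr' ?_
    filter_upwards [self_mem_nhdsWithin] with t (ht : 0 < t)
    rw [smul_inv_smul₀ (by positivity)]
  have hxy : Tendsto x (𝓝[>] 0) (𝓝 y) := by simpa using hd.add_const y
  have hcontdot : Continuous fun q : (Fin N → ℝ) × (Fin N → ℝ) => q.1 ⬝ᵥ q.2 :=
    continuous_fst.dotProduct continuous_snd
  have hl1 : Tendsto (fun t : ℝ => (c - y) ⬝ᵥ ((t ^ 2)⁻¹ • (x t - y))) (𝓝[>] 0)
      (𝓝 ((c - y) ⬝ᵥ W)) := (hcontdot.tendsto _).comp (tendsto_const_nhds.prodMk_nhds hlim)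
  have hl2 : Tendsto (fun t : ℝ => (1 / 2) * (((t ^ 2)⁻¹ • (x t - y)) ⬝ᵥ (x t - y))) (𝓝[>] 0)
      (𝓝 0) := by
    have h1 := ((hcontdot.tendsto _).comp (hlim.prodMk_nhds hd)).const_mul (1 / 2)
    simpa using h1
  refine le_of_tendsto_of_tendsto hl1 hl2 ?_
  filter_upwards [hxF, hxy.eventually hc, self_mem_nhdsWithin] with t htF htc (ht : 0 < t)
  have h1 := htc htF
  have h2 : c - x t = (c - y) - (x t - y) := by abel
  rw [h2, sub_dotProduct_self (c - y)] at h1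
  rw [dotProduct_smul, smul_dotProduct, smul_eq_mul, smul_eq_mul]
  have h3 : 0 ≤ (t ^ 2)⁻¹ := by positivity
  nlinarith

theorem TangentTo.lieBr (hTX : TangentTo F X) (hTY : TangentTo F Y)
    (hF : ∀ y ∈ F, ∃ ρ > 0, IsCompact (F ∩ Metric.closedBall y ρ))
    (hX : ∀ y ∈ F, ContDiffAt ℝ 1 X y) (hY : ∀ y ∈ F, ContDiffAt ℝ 1 Y y) :
    TangentTo F (lieBr X Y) := by
  intro p hp c hc
  have h1 := hTX.dotProduct_lieBr_nonpos hTY hp (hF p hp) (hX p hp) (hY p hp) hc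
  have h2 := hTY.dotProduct_lieBr_nonpos hTX hp (hF p hp) (hY p hp) (hX p hp) hc
  have h3 : _root_.lieBr Y X p = -_root_.lieBr X Y p := by simp [_root_.lieBr]
  rw [h3, dotProduct_neg] at h2
  linarith

theorem TangentTo.eventually_mem_of_hasDerivAt (hT : TangentTo F X) {c : ℝ → Fin N → ℝ}
    (h0 : c 0 ∈ F) (hF : ∃ ρ > 0, IsCompact (F ∩ Metric.closedBall (c 0) ρ))
    (hX : ContDiffAt ℝ 1 X (c 0)) (hc : ∀ᶠ s in 𝓝 0, HasDerivAt c (X (c s)) s) :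
    ∀ᶠ s in 𝓝 0, 0 ≤ s → c s ∈ F := by
  obtain ⟨ρ, hρ, hcpt, L, hL⟩ := exists_isCompact_inter_closedBall_lipschitzOnWith hF hX
  have hcont : ContinuousAt (fun s => (N + 2) * ‖c s - c 0‖) 0 :=
    continuousAt_const.mul ((hc.self_of_nhds.continuousAt.sub continuousAt_const).norm)
  have hlt := hcont.eventually_lt_const (by simpa using hρ)
  obtain ⟨δ, hδ, hball⟩ := Metric.nhds_basis_ball.eventually_iff.1 (hc.and hlt)
  filter_upwards [Metric.ball_mem_nhds 0 hδ] with T hTδ hT0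
  rcases hT0.eq_or_lt with rfl | hTpos
  · exact h0
  have hmem : ∀ s ∈ Icc 0 T, s ∈ Metric.ball (0 : ℝ) δ := by
    intro s hs
    rw [mem_ball_zero_iff, Real.norm_of_nonneg hs.1]
    rw [mem_ball_zero_iff, Real.norm_of_nonneg hT0] at hTδ
    exact hs.2.trans_lt hTδ
  obtain ⟨p, hp, hpT⟩ := hT.exists_near (η := 0) h0 hcpt hL hTpos
    (fun s hs => (hball (hmem s hs)).1) (fun s hs => (hball (hmem s hs)).2) (by simp) h0
  have h1 : ‖c T - p‖ ^ 2 = 0 := le_antisymm (by simpa using hpT) (sq_nonneg _)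
  have h2 : c T = p := by simpa [sub_eq_zero] using h1
  exact h2 ▸ hp.1

end Brackets

section MaximumSet

variable {N : ℕ}

theorem tangentTo_of_exists_linearized_inequality {Ω : Set (Fin N → ℝ)} (hΩ : IsOpen Ω)
    {u : (Fin N → ℝ) → ℝ} {M : ℝ} (hu : ContDiffOn ℝ 2 u Ω) (hM : 0 ≤ M)
    (hmax : ∀ x ∈ Ω, u x ≤ M) {r : ℕ} {X : Fin r → (Fin N → ℝ) → (Fin N → ℝ)}
    (hX : ∀ k, ContinuousOn (X k) Ω)
    (hineq : ∀ y ∈ Ω, IsLocalMax u y → 0 ≤ u y → ∃ C, 0 ≤ C ∧ ∀ᶠ z in 𝓝 y,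
      0 ≤ ∑ k, fderiv ℝ (fderiv ℝ u) z (X k z) (X k z) + C * ‖fderiv ℝ u z‖
        + C * max (-u z) 0) (k : Fin r) :
    TangentTo {x ∈ Ω | u x = M} (X k) := by
  rintro p ⟨hpΩ, hpM⟩ c hc
  have hΩp : Ω ∈ 𝓝 p := hΩ.mem_nhds hpΩ
  have hloc : IsLocalMax u p := by
    filter_upwards [hΩp] with x hx
    exact (hmax x hx).trans_eq hpM.symm
  have hnn : 0 ≤ u p := hM.trans_eq hpM.symm
  obtain ⟨C, hC, hev⟩ := hineq p hpΩ hloc hnn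
  set g : (Fin N → ℝ) → ℝ :=
    fun z => 2 * ((c - p) ⬝ᵥ (z - p)) - 2 * ((z - p) ⬝ᵥ (z - p)) with hg
  have hgs : ContDiff ℝ 2 g := by
    simp only [hg, dotProduct]
    fun_prop
  have hgp : ∀ v, fderiv ℝ g p v = 2 * ((c - p) ⬝ᵥ v) := by
    intro v
    have hline : HasDerivAt (fun t : ℝ => p + t • v) v 0 := by
      simpa using ((hasDerivAt_id (0 : ℝ)).smul_const v).const_add p
    have hgd : HasFDerivAt g (fderiv ℝ g p) (p + (0 : ℝ) • v) := by
      rw [zero_smul, add_zero]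
      exact (hgs.differentiable two_ne_zero p).hasFDerivAt
    have h1 := hgd.comp_hasDerivAt (0 : ℝ) hline
    have h2 : g ∘ (fun t : ℝ => p + t • v)
        = fun t : ℝ => t * (2 * ((c - p) ⬝ᵥ v)) - t ^ 2 * (2 * (v ⬝ᵥ v)) := by
      ext t
      simp only [hg, Function.comp_apply, add_sub_cancel_left, dotProduct_smul, smul_dotProduct,
        smul_eq_mul]
      ring
    have h3 : HasDerivAt (fun t : ℝ => t * (2 * ((c - p) ⬝ᵥ v)) - t ^ 2 * (2 * (v ⬝ᵥ v)))
        (2 * ((c - p) ⬝ᵥ v)) 0 := by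
      have := ((hasDerivAt_id (0 : ℝ)).mul_const (2 * ((c - p) ⬝ᵥ v))).sub
        (((hasDerivAt_id (0 : ℝ)).pow 2).mul_const (2 * (v ⬝ᵥ v)))
      exact this.congr_deriv (by simp)
    rw [h2] at h1
    exact h1.unique h3
  have hlt : ∀ᶠ z in 𝓝 p, z ≠ p → u z = u p → g z < 0 := by
    filter_upwards [hc, hΩp] with z hz hzΩ hzp hzu
    have h1 := hz ⟨hzΩ, hzu.trans hpM⟩
    have h2 : c - z = (c - p) - (z - p) := by abel
    rw [h2, sub_dotProduct_self (c - p)] at h1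
    have h3 : 0 < ‖z - p‖ ^ 2 := by
      have := norm_pos_iff.2 (sub_ne_zero.2 hzp)
      positivity
    have h4 := norm_sq_le_dotProduct_self (z - p)
    simp only [hg]
    linarith
  have h := fderiv_apply_eq_zero_of_local_max_set (hu.contDiffAt hΩp) hgs
    (fun k => (hX k).continuousAt hΩp) hev hC hloc hnn (by simp [hg]) hlt k
  rw [hgp] at h
  linarith

theorem LieSpan.contDiffOn_and_tangentTo {Ω F : Set (Fin N → ℝ)} (hΩ : IsOpen Ω) (hFΩ : F ⊆ Ω)
    (hF : ∀ y ∈ F, ∃ ρ > 0, IsCompact (F ∩ Metric.closedBall y ρ))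
    {S : Set ((Fin N → ℝ) → (Fin N → ℝ))}
    (hS : ∀ X ∈ S, ContDiffOn ℝ (⊤ : ℕ∞) X Ω ∧ TangentTo F X)
    {Z : (Fin N → ℝ) → (Fin N → ℝ)} (hZ : LieSpan Ω S Z) :
    ContDiffOn ℝ (⊤ : ℕ∞) Z Ω ∧ TangentTo F Z := by
  induction hZ with
  | base X hX => exact hS X hX
  | smul f X hf _ ih =>
    refine ⟨hf.smul ih.1, fun p hp c hc => ?_⟩
    rw [dotProduct_smul, ih.2 p hp c hc, smul_zero]
  | add X Y _ _ ihX ihY =>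
    refine ⟨ihX.1.add ihY.1, fun p hp c hc => ?_⟩
    rw [dotProduct_add, ihX.2 p hp c hc, ihY.2 p hp c hc, add_zero]
  | bracket X Y _ _ ihX ihY =>
    have h1 : ∀ {W : (Fin N → ℝ) → (Fin N → ℝ)}, ContDiffOn ℝ (⊤ : ℕ∞) W Ω →
        ∀ y ∈ F, ContDiffAt ℝ 1 W y := fun hW y hy =>
      (hW.contDiffAt (hΩ.mem_nhds (hFΩ hy))).of_le (by exact_mod_cast le_top)
    exact ⟨((ihY.1.fderiv_of_isOpen hΩ le_rfl).clm_apply ihX.1).sub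
      ((ihX.1.fderiv_of_isOpen hΩ le_rfl).clm_apply ihY.1),
      ihX.2.lieBr ihY.2 hF (h1 ihX.1) (h1 ihY.1)⟩

theorem exists_isCompact_inter_closedBall {Ω : Set (Fin N → ℝ)} (hΩ : IsOpen Ω)
    {u : (Fin N → ℝ) → ℝ} (hu : ContinuousOn u Ω) (M : ℝ) {y : Fin N → ℝ} (hy : y ∈ Ω) :
    ∃ ρ > 0, IsCompact ({x ∈ Ω | u x = M} ∩ Metric.closedBall y ρ) := by
  obtain ⟨ρ, hρ, hsub⟩ := Metric.nhds_basis_closedBall.mem_iff.1 (hΩ.mem_nhds hy)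
  refine ⟨ρ, hρ, ?_⟩
  have h1 : {x ∈ Ω | u x = M} ∩ Metric.closedBall y ρ = Metric.closedBall y ρ ∩ u ⁻¹' {M} := by
    ext x
    exact ⟨fun h => ⟨h.2, h.1.2⟩, fun h => ⟨⟨hsub h.1, h.2⟩, h.1⟩⟩
  rw [h1]
  exact (isCompact_closedBall y ρ).of_isClosed_subset
    ((hu.mono hsub).preimage_isClosed_of_isClosed Metric.isClosed_closedBall isClosed_singleton)
    inter_subset_left

/-- An integral curve of a field tangent to a relatively closed set `F` which meets `F` stays
in `F`. -/
theorem TangentTo.mem_of_hasDerivAt {F : Set (Fin N → ℝ)} {Z : (Fin N → ℝ) → (Fin N → ℝ)}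
    (hT : TangentTo F Z) (hF : ∀ y ∈ F, ∃ ρ > 0, IsCompact (F ∩ Metric.closedBall y ρ))
    (hZ : ∀ y ∈ F, ContDiffAt ℝ 1 Z y) {I : Set ℝ} (hIo : IsOpen I) (hIc : IsPreconnected I)
    {γ : ℝ → Fin N → ℝ} (hγ : ∀ t ∈ I, HasDerivAt γ (Z (γ t)) t)
    (hcl : ∀ t ∈ I, t ∈ closure {s ∈ I | γ s ∈ F} → γ t ∈ F)
    {t₀ : ℝ} (ht₀ : t₀ ∈ I) (h₀ : γ t₀ ∈ F) : ∀ t ∈ I, γ t ∈ F := by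
  suffices h : I ⊆ {s ∈ I | γ s ∈ F} from fun t ht => (h ht).2
  refine hIc.subset_of_closure_inter_subset (isOpen_iff_mem_nhds.2 ?_) ⟨t₀, ht₀, ht₀, h₀⟩
    fun t ht => ⟨ht.2, hcl t ht.2 ht.1⟩
  rintro t ⟨htI, htF⟩
  have hI : ∀ᶠ s in 𝓝 t, s ∈ I := hIo.mem_nhds htI
  have hadd : Tendsto (fun s => t + s) (𝓝 0) (𝓝 t) :=
    Continuous.tendsto' (by fun_prop) _ _ (add_zero t)
  have hsub : Tendsto (fun s => t - s) (𝓝 0) (𝓝 t) :=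
    Continuous.tendsto' (by fun_prop) _ _ (sub_zero t)
  have hr : ∀ᶠ s in 𝓝 0, 0 ≤ s → γ (t + s) ∈ F :=
    hT.eventually_mem_of_hasDerivAt (c := fun s => γ (t + s)) (by simpa using htF)
      (by simpa using hF _ htF) (by simpa using hZ _ htF)
      ((hadd.eventually hI).mono fun s hs => (hγ _ hs).comp_const_add t s)
  have hl : ∀ᶠ s in 𝓝 0, 0 ≤ s → γ (t - s) ∈ F :=
    hT.neg.eventually_mem_of_hasDerivAt (c := fun s => γ (t - s)) (by simpa using htF)
      (by simpa using hF _ htF) (by rw [sub_zero]; exact (hZ _ htF).neg)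
      ((hsub.eventually hI).mono fun s hs => (hγ _ hs).comp_const_sub t s)
  have h1 : Tendsto (fun s => s - t) (𝓝 t) (𝓝 0) :=
    Continuous.tendsto' (by fun_prop) _ _ (sub_self t)
  have h2 : Tendsto (fun s => t - s) (𝓝 t) (𝓝 0) :=
    Continuous.tendsto' (by fun_prop) _ _ (sub_self t)
  filter_upwards [hI, h1.eventually hr, h2.eventually hl] with s hsI hs1 hs2
  refine ⟨hsI, ?_⟩
  rcases le_total t s with h | h
  · simpa using hs1 (sub_nonneg.2 h)
  · simpa using hs2 (sub_nonneg.2 h)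

end MaximumSet

/-- Theorem A: strong maximum principle for quasilinear
operators of Bony type. -/
theorem strong_max_principle_quasilinear
    (m : ℕ) (hm : 1 ≤ m)
    (Ω : Set (Fin (m + 1) → ℝ)) (hΩopen : IsOpen Ω) (hΩconn : IsConnected Ω)
    (a : (Fin (m + 1) → ℝ) → (Fin (m + 1) → ℝ) → Matrix (Fin (m + 1)) (Fin (m + 1)) ℝ)
    (b : (Fin (m + 1) → ℝ) → ℝ → (Fin (m + 1) → ℝ) → ℝ)
    (ha_smooth : ∀ i j, ContDiffOn ℝ (⊤ : ℕ∞)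
      (fun q : (Fin (m + 1) → ℝ) × (Fin (m + 1) → ℝ) => a q.1 q.2 i j)
      (Ω ×ˢ (Set.univ : Set (Fin (m + 1) → ℝ))))
    (hb_smooth : ContDiffOn ℝ (⊤ : ℕ∞)
      (fun q : (Fin (m + 1) → ℝ) × ℝ × (Fin (m + 1) → ℝ) => b q.1 q.2.1 q.2.2)
      (Ω ×ˢ (Set.univ : Set (ℝ × (Fin (m + 1) → ℝ)))))
    (φ ψ : (Fin (m + 1) → ℝ) → ℝ)
    (hφ : ContDiffOn ℝ (⊤ : ℕ∞) φ Ω) (hψ : ContDiffOn ℝ (⊤ : ℕ∞) ψ Ω)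
    (hQ : ∀ x ∈ Ω, Qop (m + 1) a b ψ x ≤ Qop (m + 1) a b φ x)
    -- (1) symmetry and nonnegativity of `(a^{ij})`
    (hsym : ∀ x p i j, a x p i j = a x p j i)
    (hnonneg : ∀ x p (ξ : Fin (m + 1) → ℝ), 0 ≤ ∑ i, ∑ j, a x p i j * ξ i * ξ j)
    -- (2) `∂b/∂z ≤ 0`
    (hbz : ∀ x z p, deriv (fun t : ℝ => b x t p) z ≤ 0)
    -- (3) sum-of-squares decomposition of `a^{ij}(x,Dφ(x))∂_i∂_j`
    (r : ℕ) (X : Fin r → ((Fin (m + 1) → ℝ) → (Fin (m + 1) → ℝ)))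
    (Y : (Fin (m + 1) → ℝ) → (Fin (m + 1) → ℝ))
    (hX : ∀ k, ContDiffOn ℝ (⊤ : ℕ∞) (X k) Ω)
    (hY : ContDiffOn ℝ (⊤ : ℕ∞) Y Ω)
    (hdecomp : ∀ f : (Fin (m + 1) → ℝ) → ℝ, ContDiff ℝ 2 f → ∀ x ∈ Ω,
      (∑ i, ∑ j, a x (grad (m + 1) φ x) i j * pd (m + 1) i (pd (m + 1) j f) x)
        = (∑ k, vApp (X k) (vApp (X k) f) x) + vApp Y f x)
    -- `Γ` an integral curve of `Z ∈ £(X₁,...,X_r)`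
    (Z : (Fin (m + 1) → ℝ) → (Fin (m + 1) → ℝ)) (hZ : LieSpan Ω (Set.range X) Z)
    (I : Set ℝ) (hIopen : IsOpen I) (hIconn : IsPreconnected I)
    (γ : ℝ → (Fin (m + 1) → ℝ)) (hγΩ : ∀ t ∈ I, γ t ∈ Ω)
    (hγ : ∀ t ∈ I, HasDerivAt γ (Z (γ t)) t)
    -- `φ − ψ` attains a nonnegative maximum over `Ω` at a point of `Γ`
    (t₀ : ℝ) (ht₀ : t₀ ∈ I)
    (hmax : ∀ x ∈ Ω, φ x - ψ x ≤ φ (γ t₀) - ψ (γ t₀))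
    (hnn : 0 ≤ φ (γ t₀) - ψ (γ t₀)) :
    ∀ t ∈ I, φ (γ t) - ψ (γ t) = φ (γ t₀) - ψ (γ t₀) := by
  have hu : ContDiffOn ℝ (⊤ : ℕ∞) (fun x => φ x - ψ x) Ω := hφ.sub hψ
  set F : Set (Fin (m + 1) → ℝ) := {x ∈ Ω | φ x - ψ x = φ (γ t₀) - ψ (γ t₀)} with hF
  have hcpt : ∀ y ∈ F, ∃ ρ > 0, IsCompact (F ∩ Metric.closedBall y ρ) := fun y hy =>
    exists_isCompact_inter_closedBall hΩopen hu.continuousOn _ hy.1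
  have hXT : ∀ k, TangentTo F (X k) :=
    tangentTo_of_exists_linearized_inequality hΩopen
      (hu.of_le (WithTop.coe_le_coe.2 (le_top (a := (2 : ℕ∞))))) hnn hmax
      (fun k => (hX k).continuousOn) fun y hy hloc hy0 =>
        exists_linearized_inequality hΩopen ha_smooth hb_smooth hφ hψ hQ hbz hX hdecomp hy hloc hy0
  obtain ⟨hZs, hZT⟩ := hZ.contDiffOn_and_tangentTo hΩopen (fun x hx => hx.1) hcpt
    (by rintro _ ⟨k, rfl⟩; exact ⟨hX k, hXT k⟩)
  refine fun t ht => (hZT.mem_of_hasDerivAt hcpt (fun y hy =>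
    (hZs.contDiffAt (hΩopen.mem_nhds hy.1)).of_le (by exact_mod_cast le_top)) hIopen hIconn hγ
    (fun t ht htc => ⟨hγΩ t ht, ?_⟩) ht₀ ⟨hγΩ t₀ ht₀, rfl⟩ t ht).2
  have hcont : ContinuousAt (fun s => φ (γ s) - ψ (γ s)) t :=
    ContinuousAt.comp (g := fun x => φ x - ψ x)
      (hu.continuousOn.continuousAt (hΩopen.mem_nhds (hγΩ t ht))) (hγ t ht).continuousAt
  have h := hcont.continuousWithinAt.mem_closure_image htc
  refine (closure_minimal ?_ isClosed_singleton) h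
  rintro _ ⟨s, hs, rfl⟩
  exact hs.2.2
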